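/- arXiv:2603.01721 — 2 statements merged into one kernel-verified Lean document; each statement's English description precedes it below -/
import Mathlib

section
/- For all fixed z₁, z₂ ∈ ℝ and ρ ∈ (−1,1), the second derivative of the bivariate normal cdf with respect to the correlation parameter satisfies ∂²Φ₂(z₁,z₂;ρ)/∂ρ² = φ₂(z₁,z₂;ρ) · (z₁z₂ + (1 − z₁² − z₂²)ρ + z₁z₂ρ² − ρ³) / (1−ρ²)². -/
open MeasureTheory Real Set Filter

/-- Standard univariate normal cdf Φ. -/
noncomputable def stdNormalCDF (z : ℝ) : ℝ :=
  ∫ x in Set.Iic z, (Real.sqrt (2 * Real.pi))⁻¹ * Real.exp (-(x ^ 2) / 2)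

/-- Φ⁻¹, the (left-)inverse of the standard normal cdf. -/
noncomputable def stdNormalInv : ℝ → ℝ := Function.invFun stdNormalCDF

/-- Standard bivariate normal density φ₂(x,y;ρ), ρ ∈ (−1,1). -/
noncomputable def phi2 (ρ x y : ℝ) : ℝ :=
  (2 * Real.pi * Real.sqrt (1 - ρ ^ 2))⁻¹ *
    Real.exp (-(x ^ 2 - 2 * ρ * x * y + y ^ 2) / (2 * (1 - ρ ^ 2)))

/-- Standard bivariate normal cdf Φ₂(z₁,z₂;ρ) = ∫_{−∞}^{z₁} ∫_{−∞}^{z₂} φ₂(x,y;ρ) dy dx. -/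
noncomputable def Phi2 (ρ z₁ z₂ : ℝ) : ℝ :=
  ∫ x in Set.Iic z₁, ∫ y in Set.Iic z₂, phi2 ρ x y



noncomputable def sg (t : ℝ) : ℝ := (Real.sqrt (2 * Real.pi))⁻¹ * Real.exp (-(t ^ 2) / 2)

lemma sg_cont : Continuous sg := by unfold sg; fun_prop
lemma sg_pos (t : ℝ) : 0 < sg t := by unfold sg; positivity
lemma sg_le (t : ℝ) : sg t ≤ 1 := by
  unfold sg
  have h1 : Real.exp (-(t ^ 2) / 2) ≤ 1 := by
    rw [Real.exp_le_one_iff]; nlinarith [sq_nonneg t]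
  have h2 : (Real.sqrt (2 * Real.pi))⁻¹ ≤ 1 := by
    apply inv_le_one_of_one_le₀
    rw [Real.one_le_sqrt]; nlinarith [Real.pi_gt_three]
  have := Real.exp_pos (-(t ^ 2) / 2)
  have : 0 ≤ (Real.sqrt (2 * Real.pi))⁻¹ := by positivity
  nlinarith

lemma sg_int : Integrable sg := by
  have := (integrable_exp_neg_mul_sq (b := 1/2) (by norm_num)).const_mul (Real.sqrt (2 * Real.pi))⁻¹
  refine this.congr (Eventually.of_forall fun x => ?_)
  simp only [sg]; congr 2; ring

lemma sg_int_mul : Integrable (fun x => x * sg x) := by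
  have := (integrable_mul_exp_neg_mul_sq (b := 1/2) (by norm_num)).const_mul (Real.sqrt (2 * Real.pi))⁻¹
  refine this.congr (Eventually.of_forall fun x => ?_)
  simp only [sg]
  rw [show -(1/2:ℝ) * x^2 = -(x^2)/2 by ring]; ring

lemma cdf_eq (z : ℝ) : stdNormalCDF z = ∫ x in Set.Iic z, sg x := rfl

lemma cdf_deriv (z : ℝ) : HasDerivAt stdNormalCDF (sg z) z := by
  have h : stdNormalCDF = fun z => stdNormalCDF 0 + ∫ x in (0:ℝ)..z, sg x := by
    ext z
    rw [← intervalIntegral.integral_Iic_sub_Iic sg_int.integrableOn sg_int.integrableOn, cdf_eq, cdf_eq]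
    ring
  rw [h]
  exact (intervalIntegral.integral_hasDerivAt_right sg_int.intervalIntegrable
    (sg_cont.stronglyMeasurableAtFilter _ _) sg_cont.continuousAt).const_add _

lemma cdf_nonneg (z : ℝ) : 0 ≤ stdNormalCDF z := by
  rw [cdf_eq]; exact integral_nonneg fun x => (sg_pos x).le

lemma cdf_le (z : ℝ) : stdNormalCDF z ≤ ∫ x, sg x := by
  rw [cdf_eq]
  exact setIntegral_le_integral sg_int (Eventually.of_forall fun x => (sg_pos x).le)

lemma one_sub_pos {r : ℝ} (hr : r ∈ Set.Ioo (-1 : ℝ) 1) : 0 < 1 - r ^ 2 := by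
  nlinarith [hr.1, hr.2]

lemma phi2_eq {r : ℝ} (hr : r ∈ Set.Ioo (-1 : ℝ) 1) (x y : ℝ) :
    phi2 r x y = sg x * ((Real.sqrt (1 - r ^ 2))⁻¹ * sg ((y - r * x) / Real.sqrt (1 - r ^ 2))) := by
  have h := one_sub_pos hr
  unfold phi2 sg
  have h2 : (2 * Real.pi)⁻¹ = (Real.sqrt (2 * Real.pi))⁻¹ * (Real.sqrt (2 * Real.pi))⁻¹ := by
    rw [← mul_inv, Real.mul_self_sqrt (by positivity)]
  have h3 : Real.exp (-(x ^ 2 - 2 * r * x * y + y ^ 2) / (2 * (1 - r ^ 2))) =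
      Real.exp (-(x ^ 2) / 2) * Real.exp (-(((y - r * x) / Real.sqrt (1 - r ^ 2)) ^ 2) / 2) := by
    rw [← Real.exp_add, div_pow, Real.sq_sqrt h.le]
    congr 1
    field_simp
    ring
  rw [h3, mul_inv, h2]
  ring

lemma inner_eq {r : ℝ} (hr : r ∈ Set.Ioo (-1 : ℝ) 1) (x z : ℝ) :
    ∫ y in Set.Iic z, phi2 r x y =
      sg x * stdNormalCDF ((z - r * x) / Real.sqrt (1 - r ^ 2)) := by
  have hs : 0 < Real.sqrt (1 - r ^ 2) := Real.sqrt_pos.2 (one_sub_pos hr)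
  simp_rw [phi2_eq hr]
  rw [integral_const_mul, cdf_eq]
  congr 1
  set s := Real.sqrt (1 - r ^ 2)
  have him : (fun y => (y - r * x) / s) '' Set.Iic z = Set.Iic ((z - r * x) / s) := by
    ext t
    simp only [Set.mem_image, Set.mem_Iic]
    constructor
    · rintro ⟨y, hy, rfl⟩
      gcongr
    · intro ht
      refine ⟨t * s + r * x, ?_, by field_simp; ring⟩
      rw [le_div_iff₀ hs] at ht
      linarith
  rw [← him, integral_image_eq_integral_abs_deriv_smul (f' := fun _ => s⁻¹) measurableSet_Iic]
  · simp [abs_of_pos hs]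
  · intro y _
    have := ((hasDerivAt_id y).sub_const (r * x)).div_const s
    simpa using this.hasDerivWithinAt
  · intro a _ b _ hab
    simp only at hab
    field_simp at hab
    linarith

lemma Phi2_eq {r : ℝ} (hr : r ∈ Set.Ioo (-1 : ℝ) 1) (z₁ z₂ : ℝ) :
    Phi2 r z₁ z₂ = ∫ x in Set.Iic z₁, sg x * stdNormalCDF ((z₂ - r * x) / Real.sqrt (1 - r ^ 2)) := by
  unfold Phi2; simp_rw [inner_eq hr]

lemma u_deriv {r : ℝ} (hr : r ∈ Set.Ioo (-1 : ℝ) 1) (x z : ℝ) :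
    HasDerivAt (fun r => (z - r * x) / Real.sqrt (1 - r ^ 2))
      ((Real.sqrt (1 - r ^ 2))⁻¹ * ((r * z - x) / (1 - r ^ 2))) r := by
  have h := one_sub_pos hr
  have hs : 0 < Real.sqrt (1 - r ^ 2) := Real.sqrt_pos.2 h
  have h1 : HasDerivAt (fun r : ℝ => 1 - r ^ 2) (-(2 * r)) r := by
    simpa using ((hasDerivAt_pow 2 r).const_sub 1)
  have h2 := h1.sqrt h.ne'
  have h3 : HasDerivAt (fun r : ℝ => z - r * x) (-x) r := by
    simpa using ((hasDerivAt_id r).mul_const x).const_sub z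
  refine (h3.div h2 hs.ne').congr_deriv ?_
  rw [Real.sq_sqrt h.le]
  have e := Real.sq_sqrt h.le
  set s := Real.sqrt (1 - r ^ 2)
  field_simp
  rw [e]; ring

lemma integrand_deriv {r : ℝ} (hr : r ∈ Set.Ioo (-1 : ℝ) 1) (x z : ℝ) :
    HasDerivAt (fun r => sg x * stdNormalCDF ((z - r * x) / Real.sqrt (1 - r ^ 2)))
      (phi2 r x z * ((r * z - x) / (1 - r ^ 2))) r := by
  refine (((cdf_deriv _).comp r (u_deriv hr x z)).const_mul (sg x)).congr_deriv ?_
  rw [phi2_eq hr]; ring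

lemma phi2_deriv_x {r : ℝ} (hr : r ∈ Set.Ioo (-1 : ℝ) 1) (x z : ℝ) :
    HasDerivAt (fun x => phi2 r x z) (phi2 r x z * ((r * z - x) / (1 - r ^ 2))) x := by
  have h := one_sub_pos hr
  unfold phi2
  have h1 : HasDerivAt (fun x : ℝ => -(x ^ 2 - 2 * r * x * z + z ^ 2) / (2 * (1 - r ^ 2)))
      ((r * z - x) / (1 - r ^ 2)) x := by
    have := (((((hasDerivAt_pow 2 x).sub (((hasDerivAt_id x).const_mul (2 * r)).mul_const z)).add_const
      (z ^ 2)).neg).div_const (2 * (1 - r ^ 2)))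
    refine this.congr_deriv ?_
    simp
    field_simp
  refine (h1.exp.const_mul _).congr_deriv ?_
  ring

lemma phi2_deriv_r {r : ℝ} (hr : r ∈ Set.Ioo (-1 : ℝ) 1) (x y : ℝ) :
    HasDerivAt (fun r => phi2 r x y)
      (phi2 r x y * (x * y + (1 - x ^ 2 - y ^ 2) * r + x * y * r ^ 2 - r ^ 3) / (1 - r ^ 2) ^ 2) r := by
  have h := one_sub_pos hr
  have hs : 0 < Real.sqrt (1 - r ^ 2) := Real.sqrt_pos.2 h
  have h1 : HasDerivAt (fun r : ℝ => 1 - r ^ 2) (-(2 * r)) r := by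
    simpa using ((hasDerivAt_pow 2 r).const_sub 1)
  have h2 := ((h1.sqrt h.ne').const_mul (2 * Real.pi)).inv (by positivity)
  have h4 : HasDerivAt (fun r : ℝ => -(x ^ 2 - 2 * r * x * y + y ^ 2)) (2 * x * y) r := by
    have := (((((hasDerivAt_id r).const_mul 2).mul_const x).mul_const y).const_sub (x ^ 2)).add_const (y ^ 2)
    refine this.neg.congr_deriv ?_
    simp
  have h3 := (h4.div (h1.const_mul 2) (by positivity)).exp
  refine (h2.mul h3).congr_deriv ?_
  unfold phi2
  simp only [Pi.div_apply, Pi.inv_apply]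
  have e := Real.sq_sqrt h.le
  generalize Real.exp _ = E
  rw [mul_pow, e]
  set s := Real.sqrt (1 - r ^ 2)
  field_simp
  try rw [e]
  ring

lemma Phi2_deriv {r : ℝ} (hr : r ∈ Set.Ioo (-1 : ℝ) 1) (z₁ z₂ : ℝ) :
    HasDerivAt (fun r => Phi2 r z₁ z₂) (phi2 r z₁ z₂) r := by
  obtain ⟨c, hc1, hc2⟩ := exists_between (abs_lt.2 hr)
  have hc0 : 0 < c := (abs_nonneg r).trans_lt hc1
  have hcc : c ∈ Set.Ioo (-1 : ℝ) 1 := ⟨by linarith, hc2⟩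
  have hsub : ∀ t ∈ Set.Ioo (-c) c, t ∈ Set.Ioo (-1 : ℝ) 1 := fun t ht =>
    ⟨by linarith [ht.1], by linarith [ht.2]⟩
  have hnhds : Set.Ioo (-c) c ∈ nhds r := Ioo_mem_nhds (abs_lt.1 hc1).1 (abs_lt.1 hc1).2
  have hD := one_sub_pos hcc
  have hDs : 0 < Real.sqrt (1 - c ^ 2) := Real.sqrt_pos.2 hD
  have hcdf : Continuous stdNormalCDF :=
    continuous_iff_continuousAt.2 fun z => (cdf_deriv z).continuousAt
  have hFc : ∀ t : ℝ, Continuous (fun x => sg x * stdNormalCDF ((z₂ - t * x) / Real.sqrt (1 - t ^ 2))) :=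
    fun t => sg_cont.mul (hcdf.comp (by fun_prop))
  have hphic : Continuous (fun x => phi2 r x z₂) :=
    continuous_iff_continuousAt.2 fun x => (phi2_deriv_x hr x z₂).continuousAt
  have hF'c : Continuous (fun x => phi2 r x z₂ * ((r * z₂ - x) / (1 - r ^ 2))) :=
    hphic.mul (by fun_prop)
  have hphib : ∀ t ∈ Set.Ioo (-c) c, ∀ x, 0 ≤ phi2 t x z₂ ∧
      phi2 t x z₂ ≤ (Real.sqrt (1 - c ^ 2))⁻¹ * sg x := by
    intro t ht x
    rw [phi2_eq (hsub t ht)]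
    have hle : Real.sqrt (1 - c ^ 2) ≤ Real.sqrt (1 - t ^ 2) :=
      Real.sqrt_le_sqrt (by nlinarith [ht.1, ht.2])
    have hle' := inv_anti₀ hDs hle
    have hp : 0 < (Real.sqrt (1 - t ^ 2))⁻¹ := inv_pos.2 (hDs.trans_le hle)
    have a := sg_pos x
    have b := sg_pos ((z₂ - t * x) / Real.sqrt (1 - t ^ 2))
    refine ⟨by positivity, ?_⟩
    rw [mul_comm]
    refine mul_le_mul_of_nonneg_right ?_ a.le
    calc _ ≤ (Real.sqrt (1 - t ^ 2))⁻¹ * 1 := mul_le_mul_of_nonneg_left (sg_le _) hp.le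
      _ ≤ _ := by rwa [mul_one]
  set bound : ℝ → ℝ := fun x =>
    (Real.sqrt (1 - c ^ 2))⁻¹ * (1 - c ^ 2)⁻¹ * (|z₂| * sg x + ‖x * sg x‖) with hbdef
  have hbint : Integrable bound :=
    ((sg_int.const_mul _).add sg_int_mul.norm).const_mul _
  have hb : ∀ x, ∀ t ∈ Set.Ioo (-c) c,
      ‖phi2 t x z₂ * ((t * z₂ - x) / (1 - t ^ 2))‖ ≤ bound x := by
    intro x t ht
    obtain ⟨p0, p1⟩ := hphib t ht x
    have hT := one_sub_pos (hsub t ht)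
    have hle : 1 - c ^ 2 ≤ 1 - t ^ 2 := by nlinarith [ht.1, ht.2]
    have h1 : |t * z₂ - x| ≤ |z₂| + |x| := by
      refine (abs_sub _ _).trans ?_
      rw [abs_mul]
      have : |t| ≤ 1 := (abs_lt.2 (hsub t ht)).le
      nlinarith [abs_nonneg z₂]
    have h2 : |t * z₂ - x| / (1 - t ^ 2) ≤ (|z₂| + |x|) / (1 - c ^ 2) := by gcongr
    rw [norm_mul, Real.norm_of_nonneg p0, norm_div, Real.norm_of_nonneg hT.le, Real.norm_eq_abs]
    calc _ ≤ ((Real.sqrt (1 - c ^ 2))⁻¹ * sg x) * ((|z₂| + |x|) / (1 - c ^ 2)) :=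
          mul_le_mul p1 h2 (by positivity) (p0.trans p1)
      _ = _ := by
          simp only [hbdef, norm_mul, Real.norm_eq_abs, abs_of_pos (sg_pos x)]
          ring
  have key := (hasDerivAt_integral_of_dominated_loc_of_deriv_le (μ := volume.restrict (Set.Iic z₁))
    (F := fun t x => sg x * stdNormalCDF ((z₂ - t * x) / Real.sqrt (1 - t ^ 2)))
    (F' := fun t x => phi2 t x z₂ * ((t * z₂ - x) / (1 - t ^ 2))) (bound := bound)
    (x₀ := r) hnhds
    (Eventually.of_forall fun t => (hFc t).aestronglyMeasurable)
    (by
      refine Integrable.restrict ?_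
      refine (sg_int.mul_const (∫ x, sg x)).mono' (hFc r).aestronglyMeasurable
        (Eventually.of_forall fun x => ?_)
      rw [Real.norm_of_nonneg (mul_nonneg (sg_pos x).le (cdf_nonneg _))]
      exact mul_le_mul_of_nonneg_left (cdf_le _) (sg_pos x).le)
    hF'c.aestronglyMeasurable
    (Eventually.of_forall hb)
    hbint.restrict
    (Eventually.of_forall fun x t ht => integrand_deriv (hsub t ht) x z₂)).2
  have hrc : r ∈ Set.Ioo (-c) c := abs_lt.1 hc1
  have hint : Integrable (fun x => phi2 r x z₂ * ((r * z₂ - x) / (1 - r ^ 2))) :=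
    hbint.mono' hF'c.aestronglyMeasurable (Eventually.of_forall fun x => hb x r hrc)
  have hsg0 : Tendsto (fun x => sg x) atBot (nhds 0) := by
    have h1 : Tendsto (fun x : ℝ => x ^ 2) atBot atTop := by
      simpa [Function.comp_def] using (tendsto_pow_atTop (α := ℝ) (n := 2) (by norm_num)).comp tendsto_abs_atBot_atTop
    have h2 := (Real.tendsto_exp_neg_atTop_nhds_zero.comp
      (h1.atTop_div_const (r := 2) (by norm_num))).const_mul (Real.sqrt (2 * Real.pi))⁻¹
    rw [mul_zero] at h2
    refine h2.congr fun x => ?_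
    simp only [sg, Function.comp, neg_div]
  have hlim : Tendsto (fun x => phi2 r x z₂) atBot (nhds 0) := by
    refine squeeze_zero (fun x => (hphib r hrc x).1) (fun x => (hphib r hrc x).2) ?_
    simpa using hsg0.const_mul (Real.sqrt (1 - c ^ 2))⁻¹
  have hval := integral_Iic_of_hasDerivAt_of_tendsto (a := z₁)
    hphic.continuousWithinAt (fun x _ => phi2_deriv_x hr x z₂) hint.integrableOn hlim
  rw [hval, sub_zero] at key
  refine key.congr_of_eventuallyEq ?_
  filter_upwards [hnhds] with t ht using Phi2_eq (hsub t ht) z₁ z₂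

/-- second derivative of Φ₂ with respect to the correlation parameter. -/
theorem Phi2_second_deriv_correlation (z₁ z₂ : ℝ) (ρ : ℝ) (hρ : ρ ∈ Set.Ioo (-1 : ℝ) 1) :
    deriv (deriv (fun r => Phi2 r z₁ z₂)) ρ =
      phi2 ρ z₁ z₂ *
        (z₁ * z₂ + (1 - z₁ ^ 2 - z₂ ^ 2) * ρ + z₁ * z₂ * ρ ^ 2 - ρ ^ 3) / (1 - ρ ^ 2) ^ 2 := by
  have h : deriv (fun r => Phi2 r z₁ z₂) =ᶠ[nhds ρ] fun r => phi2 r z₁ z₂ := by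
    filter_upwards [Ioo_mem_nhds hρ.1 hρ.2] with t ht using (Phi2_deriv ht z₁ z₂).deriv
  rw [h.deriv_eq]
  exact (phi2_deriv_r hρ z₁ z₂).deriv
end

section
/- Fix u = (u₁,u₂) ∈ (0,1)² and α₀ ∈ ℝ. Define z_i := Φ⁻¹(u_i), C(α) := Φ₂(z₁, z₂; tanh α), and the quadrant masses p₁(α) := C(α), p₂(α) := u₁ − C(α), p₃(α) := u₂ − C(α), p₄(α) := 1 − u₁ − u₂ + C(α). Then all pⱼ(α₀) are strictly positive, the population criterion ℓ(α) := Σ_{j=1}^{4} pⱼ(α₀) log pⱼ(α) is well defined for every α ∈ ℝ, and α₀ is its unique global maximizer on ℝ: ℓ(α₀) > ℓ(α) for every α ≠ α₀. -/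
open MeasureTheory Real Set Filter

open ProbabilityTheory in
lemma cdf_eq_measure (z : ℝ) : stdNormalCDF z = (gaussianReal 0 1).real (Iic z) := by
  rw [measureReal_def, gaussianReal_apply_eq_integral 0 one_ne_zero,
    ENNReal.toReal_ofReal (integral_nonneg fun x => gaussianPDFReal_nonneg _ _ _)]
  simp [stdNormalCDF, gaussianPDFReal]

open ProbabilityTheory in
lemma cdf_strictMono : StrictMono stdNormalCDF := by
  intro a b hab
  have h : Iic b = Iic a ∪ Ioc a b := (Iic_union_Ioc_eq_Iic hab.le).symm
  rw [cdf_eq_measure, cdf_eq_measure, h, measureReal_union (by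
    rw [Set.disjoint_left]; intro x hx hx'; exact absurd hx'.1 (not_lt.mpr hx)) measurableSet_Ioc]
  have : 0 < (gaussianReal 0 1).real (Ioc a b) := by
    rw [measureReal_def, ENNReal.toReal_pos_iff]
    refine ⟨?_, measure_lt_top _ _⟩
    rw [pos_iff_ne_zero]
    intro h0
    have := gaussianReal_absolutelyContinuous' 0 one_ne_zero h0
    simp at this
    linarith
  linarith

lemma cdf_continuous : Continuous stdNormalCDF := by
  have hi : Integrable (fun x : ℝ => (Real.sqrt (2 * Real.pi))⁻¹ * Real.exp (-(x ^ 2) / 2)) := by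
    have := ProbabilityTheory.integrable_gaussianPDFReal 0 1
    simpa [ProbabilityTheory.gaussianPDFReal_def] using this
  have : stdNormalCDF = fun z => stdNormalCDF 0 +
      ∫ x in (0:ℝ)..z, (Real.sqrt (2 * Real.pi))⁻¹ * Real.exp (-(x ^ 2) / 2) := by
    funext z
    rw [← intervalIntegral.integral_Iic_sub_Iic hi.integrableOn hi.integrableOn]
    simp [stdNormalCDF]
  rw [this]
  exact continuous_const.add (intervalIntegral.continuous_primitive
    (fun a b => hi.intervalIntegrable) 0)

lemma cdf_inv (u : ℝ) (hu : u ∈ Ioo (0:ℝ) 1) : stdNormalCDF (stdNormalInv u) = u := by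
  apply Function.invFun_eq
  have e : stdNormalCDF = ProbabilityTheory.cdf (ProbabilityTheory.gaussianReal 0 1) := by
    funext z; rw [cdf_eq_measure, ProbabilityTheory.cdf_eq_real]
  have h0 := ProbabilityTheory.tendsto_cdf_atBot (ProbabilityTheory.gaussianReal 0 1)
  have h1 := ProbabilityTheory.tendsto_cdf_atTop (ProbabilityTheory.gaussianReal 0 1)
  rw [← e] at h0 h1
  obtain ⟨a, ha⟩ := (h0.eventually_lt_const hu.1).exists
  obtain ⟨b, hb⟩ := (h1.eventually_const_lt hu.2).exists
  exact mem_range_of_exists_le_of_exists_ge cdf_continuous ⟨a, ha.le⟩ ⟨b, hb.le⟩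

lemma cdf_pos (z : ℝ) : 0 < stdNormalCDF z :=
  lt_of_le_of_lt (by rw [cdf_eq_measure]; exact measureReal_nonneg)
    (cdf_strictMono (sub_one_lt z))

lemma cdf_lt_one (z : ℝ) : stdNormalCDF z < 1 :=
  lt_of_lt_of_le (cdf_strictMono (lt_add_one z))
    (by rw [cdf_eq_measure]; exact measureReal_le_one)

open ProbabilityTheory in
lemma inner_eq_s7 (α x z : ℝ) : ∫ y in Iic z, phi2 (Real.tanh α) x y =
    gaussianPDFReal 0 1 x * stdNormalCDF (z * Real.cosh α - x * Real.sinh α) := by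
  have hc := Real.cosh_pos α
  have hs : 1 - Real.tanh α ^ 2 = (Real.cosh α ^ 2)⁻¹ := by
    rw [Real.tanh_eq_sinh_div_cosh, div_pow, Real.sinh_sq]; field_simp; ring
  set c := Real.cosh α with hcd
  set s := Real.sinh α with hsd
  have hcs : c ^ 2 = s ^ 2 + 1 := Real.cosh_sq α
  have hphi : ∀ y, phi2 (Real.tanh α) x y =
      gaussianPDFReal 0 1 x * (c * gaussianPDFReal 0 1 (y * c - x * s)) := by
    intro y
    have hsq : √((c ^ 2)⁻¹) = c⁻¹ := by rw [Real.sqrt_inv, Real.sqrt_sq hc.le]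
    have hpi : (√(2 * π))⁻¹ * (√(2 * π))⁻¹ = (2 * π)⁻¹ := by
      rw [← mul_inv, Real.mul_self_sqrt (by positivity)]
    have hexp : -(x ^ 2 - 2 * Real.tanh α * x * y + y ^ 2) / (2 * (c ^ 2)⁻¹) =
        -(x ^ 2) / 2 + -((y * c - x * s) ^ 2) / 2 := by
      rw [Real.tanh_eq_sinh_div_cosh, ← hcd, ← hsd]
      field_simp
      linear_combination (-x ^ 2 ) * hcs
    simp only [phi2, gaussianPDFReal, hs, hsq, hexp, Real.exp_add, NNReal.coe_one, mul_one, sub_zero]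
    rw [mul_inv, inv_inv, ← hpi]
    ring
  simp_rw [hphi]
  rw [integral_const_mul, integral_const_mul]
  congr 1
  rw [← integral_indicator measurableSet_Iic]
  have : (Iic z).indicator (fun y => gaussianPDFReal 0 1 (y * c - x * s)) =
      fun y => (fun w => (Iic (z * c - x * s)).indicator (gaussianPDFReal 0 1) (w - x * s)) (y * c) := by
    funext y
    have : y * c - x * s ≤ z * c - x * s ↔ y ≤ z := by
      rw [sub_le_sub_iff_right, mul_le_mul_iff_left₀ hc]
    simp [indicator, this]
  rw [this, Measure.integral_comp_mul_right, integral_sub_right_eq_self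
    (fun w => (Iic (z * c - x * s)).indicator (gaussianPDFReal 0 1) w),
    integral_indicator measurableSet_Iic, abs_of_pos (inv_pos.mpr hc), smul_eq_mul,
    ← mul_assoc, mul_inv_cancel₀ hc.ne', one_mul]
  simp [stdNormalCDF, gaussianPDFReal]

open ProbabilityTheory in
lemma Phi2_eq_s7 (α z₁ z₂ : ℝ) : Phi2 (Real.tanh α) z₁ z₂ =
    ∫ x in Iic z₁, stdNormalCDF (z₂ * Real.cosh α - x * Real.sinh α) ∂(gaussianReal 0 1) := by
  unfold Phi2
  simp_rw [inner_eq_s7]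
  rw [← integral_indicator measurableSet_Iic, ← integral_indicator measurableSet_Iic,
    integral_gaussianReal_eq_integral_smul one_ne_zero]
  congr 1
  funext x
  by_cases h : x ∈ Iic z₁ <;> simp [indicator, h]

open ProbabilityTheory in
lemma marginal (α z : ℝ) :
    ∫ x, stdNormalCDF (z * Real.cosh α - x * Real.sinh α) ∂(gaussianReal 0 1) =
      stdNormalCDF z := by
  have hc := Real.cosh_pos α
  have hcs := Real.cosh_sq α
  set c := Real.cosh α
  set s := Real.sinh α
  have h1 : ((gaussianReal 0 1).map (s * ·)) ∗ (gaussianReal 0 1) =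
      (gaussianReal 0 1).map (c * ·) := by
    rw [gaussianReal_map_const_mul, gaussianReal_map_const_mul, gaussianReal_conv_gaussianReal]
    congr 1
    · simp
    · ext; simp [hcs]
  have h2 : (gaussianReal 0 1).map (c * ·) (Iic (z * c)) = gaussianReal 0 1 (Iic z) := by
    rw [Measure.map_apply (by fun_prop) measurableSet_Iic]
    congr 1
    ext x
    simp [mul_comm c, mul_le_mul_iff_left₀ hc]
  have h3 : (((gaussianReal 0 1).map (s * ·)) ∗ (gaussianReal 0 1)) (Iic (z * c)) =
      ∫⁻ x, gaussianReal 0 1 (Iic (z * c - x * s)) ∂(gaussianReal 0 1) := by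
    rw [← lintegral_indicator_one measurableSet_Iic, Measure.lintegral_conv
      (measurable_one.indicator measurableSet_Iic)]
    have key : ∀ x, ∫⁻ y, (Iic (z * c)).indicator (1 : ℝ → ENNReal) (x + y) ∂(gaussianReal 0 1) =
        gaussianReal 0 1 (Iic (z * c - x)) := by
      intro x
      rw [← lintegral_indicator_one measurableSet_Iic]
      congr 1
      funext y
      simp only [indicator, mem_Iic, le_sub_iff_add_le', Pi.one_apply]
    simp_rw [key]
    rw [lintegral_map (Antitone.measurable (fun a b hab => measure_mono
      (Iic_subset_Iic.mpr (by linarith)))) (by fun_prop)]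
    simp_rw [mul_comm s]
  simp_rw [cdf_eq_measure, measureReal_def]
  rw [integral_toReal, ← h3, h1, h2]
  · have : Monotone fun w : ℝ => gaussianReal 0 1 (Iic w) :=
      fun a b hab => measure_mono (Iic_subset_Iic.mpr hab)
    exact (this.measurable.comp (by fun_prop : Measurable fun x : ℝ => z * c - x * s)).aemeasurable
  · exact ae_of_all _ fun x => measure_lt_top _ _

open ProbabilityTheory in
lemma integrable_cdf (α z : ℝ) : Integrable
    (fun x => stdNormalCDF (z * Real.cosh α - x * Real.sinh α)) (gaussianReal 0 1) := by
  refine Integrable.of_bound (C := 1) ?_ (ae_of_all _ fun x => ?_)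
  · exact (cdf_continuous.comp (by fun_prop)).aestronglyMeasurable
  · rw [Real.norm_eq_abs, abs_of_pos (cdf_pos _)]; exact (cdf_lt_one _).le

open ProbabilityTheory in
lemma setInt_pos (f : ℝ → ℝ) (hf : Integrable f (gaussianReal 0 1)) (S : Set ℝ)
    (hS : MeasurableSet S) (hv : volume S ≠ 0) (hpos : ∀ x ∈ S, 0 < f x) :
    0 < ∫ x in S, f x ∂(gaussianReal 0 1) := by
  rw [setIntegral_pos_iff_support_of_nonneg_ae _ hf.integrableOn]
  · have : Function.support f ∩ S = S := by
      ext x; simp only [mem_inter_iff, Function.mem_support]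
      exact ⟨fun h => h.2, fun h => ⟨(hpos x h).ne', h⟩⟩
    rw [this, pos_iff_ne_zero]
    exact fun h0 => hv (gaussianReal_absolutelyContinuous' 0 one_ne_zero h0)
  · exact (ae_restrict_iff' hS).mpr (ae_of_all _ fun x hx => (hpos x hx).le)

open ProbabilityTheory in
lemma int_split (α z₁ z₂ : ℝ) : Phi2 (Real.tanh α) z₁ z₂ +
    ∫ x in Ioi z₁, stdNormalCDF (z₂ * Real.cosh α - x * Real.sinh α) ∂(gaussianReal 0 1) =
      stdNormalCDF z₂ := by
  rw [Phi2_eq_s7, ← marginal α z₂, ← compl_Iic]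
  exact integral_add_compl measurableSet_Iic (integrable_cdf α z₂)

open ProbabilityTheory in
lemma Phi2_lt (z₁ z₂ α β : ℝ) (h : α < β) :
    Phi2 (Real.tanh α) z₁ z₂ < Phi2 (Real.tanh β) z₁ z₂ := by
  have hs : Real.sinh α < Real.sinh β := Real.sinh_lt_sinh.mpr h
  have ia := integrable_cdf α z₂
  have ib := integrable_cdf β z₂
  set x0 := z₂ * (Real.cosh β - Real.cosh α) / (Real.sinh β - Real.sinh α) with hx0
  have hx : x0 * (Real.sinh β - Real.sinh α) = z₂ * (Real.cosh β - Real.cosh α) :=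
    div_mul_cancel₀ _ (by linarith)
  rcases le_or_gt z₁ x0 with hz | hz
  · have := setInt_pos _ (ib.sub ia) (Iio z₁) measurableSet_Iio (by simp) (by
      intro x hxz
      have hxz : x < z₁ := hxz
      simp only [Pi.sub_apply, sub_pos]
      apply cdf_strictMono
      nlinarith)
    rw [← integral_Iic_eq_integral_Iio' (by
      have := nullSingletonClass_gaussianReal (μ := 0) (v := 1) one_ne_zero
      exact measure_singleton _)] at this
    simp only [Pi.sub_apply] at this
    rw [integral_sub ib.integrableOn ia.integrableOn, ← Phi2_eq_s7, ← Phi2_eq_s7] at this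
    linarith
  · have := setInt_pos _ (ia.sub ib) (Ioi z₁) measurableSet_Ioi (by simp) (by
      intro x hxz
      have hxz : z₁ < x := hxz
      simp only [Pi.sub_apply, sub_pos]
      apply cdf_strictMono
      nlinarith)
    simp only [Pi.sub_apply] at this
    rw [integral_sub ia.integrableOn ib.integrableOn] at this
    have := int_split α z₁ z₂
    have := int_split β z₁ z₂
    linarith

open ProbabilityTheory in
lemma masses_pos (α z₁ z₂ : ℝ) : 0 < Phi2 (Real.tanh α) z₁ z₂ ∧
    0 < stdNormalCDF z₁ - Phi2 (Real.tanh α) z₁ z₂ ∧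
    0 < stdNormalCDF z₂ - Phi2 (Real.tanh α) z₁ z₂ ∧
    0 < 1 - stdNormalCDF z₁ - stdNormalCDF z₂ + Phi2 (Real.tanh α) z₁ z₂ := by
  have i := integrable_cdf α z₂
  have i1 : Integrable (fun _ : ℝ => (1:ℝ)) (gaussianReal 0 1) := integrable_const 1
  have hs := int_split α z₁ z₂
  have a := setInt_pos _ i (Iic z₁) measurableSet_Iic (by simp) fun x _ => cdf_pos _
  have b := setInt_pos _ i (Ioi z₁) measurableSet_Ioi (by simp) fun x _ => cdf_pos _
  have c := setInt_pos _ (i1.sub i) (Iic z₁) measurableSet_Iic (by simp)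
    fun x _ => sub_pos.mpr (cdf_lt_one _)
  have d := setInt_pos _ (i1.sub i) (Ioi z₁) measurableSet_Ioi (by simp)
    fun x _ => sub_pos.mpr (cdf_lt_one _)
  simp only [Pi.sub_apply] at c d
  rw [integral_sub i1.integrableOn i.integrableOn] at c d
  have e1 : ∫ x in Iic z₁, (1:ℝ) ∂(gaussianReal 0 1) = stdNormalCDF z₁ := by
    rw [cdf_eq_measure]; simp
  have e2 : ∫ x in Ioi z₁, (1:ℝ) ∂(gaussianReal 0 1) = 1 - stdNormalCDF z₁ := by
    rw [cdf_eq_measure, ← compl_Iic, ← probReal_compl_eq_one_sub measurableSet_Iic]; simp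
  rw [e1, ← Phi2_eq_s7] at c
  rw [e2] at d
  rw [← Phi2_eq_s7] at a
  exact ⟨a, c, by linarith, by linarith⟩

lemma kl_le (p q : ℝ) (hp : 0 < p) (hq : 0 < q) :
    p * Real.log q ≤ p * Real.log p + (q - p) := by
  have := Real.log_le_sub_one_of_pos (div_pos hq hp)
  rw [Real.log_div hq.ne' hp.ne'] at this
  have h2 := mul_le_mul_of_nonneg_left this hp.le
  have : p * (q / p - 1) = q - p := by field_simp
  linarith

lemma kl_lt (p q : ℝ) (hp : 0 < p) (hq : 0 < q) (hne : q ≠ p) :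
    p * Real.log q < p * Real.log p + (q - p) := by
  have := Real.log_lt_sub_one_of_pos (div_pos hq hp) (fun h => hne ((div_eq_one_iff_eq hp.ne').mp h))
  rw [Real.log_div hq.ne' hp.ne'] at this
  have h2 := mul_lt_mul_of_pos_left this hp
  have : p * (q / p - 1) = q - p := by field_simp
  linarith

/-- the population distribution-regression criterion
ℓ(α) = Σⱼ pⱼ(α₀) log pⱼ(α) is well defined (all quadrant masses are strictly positive)
and α₀ is its unique global maximizer on ℝ. -/
theorem population_criterion_unique_maximizer
    (u₁ u₂ : ℝ) (hu₁ : u₁ ∈ Set.Ioo (0 : ℝ) 1) (hu₂ : u₂ ∈ Set.Ioo (0 : ℝ) 1)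
    (α₀ : ℝ) (z₁ z₂ : ℝ) (hz₁ : z₁ = stdNormalInv u₁) (hz₂ : z₂ = stdNormalInv u₂)
    (C : ℝ → ℝ) (hC : ∀ α, C α = Phi2 (Real.tanh α) z₁ z₂)
    (p₁ p₂ p₃ p₄ : ℝ → ℝ)
    (hp₁ : ∀ α, p₁ α = C α) (hp₂ : ∀ α, p₂ α = u₁ - C α)
    (hp₃ : ∀ α, p₃ α = u₂ - C α) (hp₄ : ∀ α, p₄ α = 1 - u₁ - u₂ + C α)
    (ℓ : ℝ → ℝ)
    (hℓ : ∀ α, ℓ α = p₁ α₀ * Real.log (p₁ α) + p₂ α₀ * Real.log (p₂ α) +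
      p₃ α₀ * Real.log (p₃ α) + p₄ α₀ * Real.log (p₄ α)) :
    (∀ α : ℝ, 0 < p₁ α ∧ 0 < p₂ α ∧ 0 < p₃ α ∧ 0 < p₄ α) ∧
    (∀ α : ℝ, α ≠ α₀ → ℓ α < ℓ α₀) := by
  have e1 : stdNormalCDF z₁ = u₁ := by rw [hz₁]; exact cdf_inv u₁ hu₁
  have e2 : stdNormalCDF z₂ = u₂ := by rw [hz₂]; exact cdf_inv u₂ hu₂
  have hpos : ∀ α : ℝ, 0 < p₁ α ∧ 0 < p₂ α ∧ 0 < p₃ α ∧ 0 < p₄ α := by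
    intro α
    rw [hp₁, hp₂, hp₃, hp₄, hC, ← e1, ← e2]
    exact masses_pos α z₁ z₂
  refine ⟨hpos, fun α hα => ?_⟩
  have hne : p₁ α ≠ p₁ α₀ := by
    rw [hp₁, hp₁, hC, hC]
    rcases lt_or_gt_of_ne hα with h | h
    · exact (Phi2_lt z₁ z₂ _ _ h).ne
    · exact (Phi2_lt z₁ z₂ _ _ h).ne'
  obtain ⟨a1, a2, a3, a4⟩ := hpos α
  obtain ⟨b1, b2, b3, b4⟩ := hpos α₀
  have k1 := kl_lt _ _ b1 a1 hne
  have k2 := kl_le _ _ b2 a2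
  have k3 := kl_le _ _ b3 a3
  have k4 := kl_le _ _ b4 a4
  have hsum : ∀ α, p₁ α + p₂ α + p₃ α + p₄ α = 1 := by
    intro α; rw [hp₁, hp₂, hp₃, hp₄]; ring
  have s1 := hsum α
  have s2 := hsum α₀
  rw [hℓ, hℓ]
  linarith
end
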